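/- Fix d ≥ 1, finite nonempty types 𝒳₁,…,𝒳_d, surjective maps T_i : 𝒳_i → 𝒳_{i+1} for 1 ≤ i ≤ d−1, positive reals σ₁,…,σ_d with σ̄_i := σ₁+⋯+σ_i, a loss L : 𝒳₁ → ℝ, λ ∈ ℝ, and a pmf Q on 𝒳₁ with Q(x) > 0 for all x, with hierarchical pushforwards Q^{(i)}. Define the generalized renormalization-group iterates: Z₁ := ∑_{x∈𝒳₁} exp(−(λ/σ₁)L(x)) Q(x), P¹(x) := exp(−(λ/σ₁)L(x)) Q(x)/Z₁, and for 1 ≤ i ≤ d−1, with θ_i := σ̄_i/σ̄_{i+1}: Uⁱ(y) := ∑_{x : T_i(x)=y} Pⁱ(x), Z_{i+1} := ∑_{y∈𝒳_{i+1}} Uⁱ(y)^{θ_i} Q^{(i+1)}(y)^{1−θ_i}, P^{i+1}(y) := Uⁱ(y)^{θ_i} Q^{(i+1)}(y)^{1−θ_i}/Z_{i+1}. Define P̃^{[λ]}(x) := P^d(x^{(d)}) · ∏_{i=1}^{d−1} Pⁱ(x^{(i)})/Uⁱ(x^{(i+1)}), where x^{(1)} := x and x^{(i+1)} := T_i(x^{(i)}).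 Then P̃^{[λ]} is a strictly positive pmf on 𝒳₁, and for every pmf P on 𝒳₁, with P^{(i)} and P̃^{(i)} the hierarchical pushforwards of P and of P̃^{[λ]}: ∑_{i=1}^d σ_i D(P^{(i)} ‖ Q^{(i)}) + λ ∑_x P(x)L(x) = ∑_{i=1}^d σ_i D(P^{(i)} ‖ P̃^{(i)}) − ∑_{i=1}^d σ̄_i log Z_i. -/

import Mathlib

open Finset

/-- Relative entropy of finite pmfs: `D(R‖S) = ∑_{x : R x > 0} R x log (R x / S x)`. -/
noncomputable def relEnt {α : Type*} [Fintype α] (R S : α → ℝ) : ℝ :=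
  ∑ x ∈ Finset.univ.filter (fun x => 0 < R x), R x * Real.log (R x / S x)

/-- Hierarchical pushforwards: `hpush T P 0 = P` and
`hpush T P (i+1) y = ∑_{x : T i x = y} hpush T P i x`. -/
noncomputable def hpush {X : ℕ → Type*} [∀ i, Fintype (X i)] [∀ i, DecidableEq (X i)]
    (T : ∀ i, X i → X (i + 1)) (P : X 0 → ℝ) : ∀ i, X i → ℝ
  | 0 => P
  | i + 1 => fun y => ∑ x ∈ Finset.univ.filter (fun x => T i x = y), hpush T P i x

/-- Accumulated hierarchical coefficients `σ̄_i = σ_0 + ⋯ + σ_i` (0-based). -/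
noncomputable def sbar (σ : ℕ → ℝ) (i : ℕ) : ℝ := ∑ k ∈ Finset.range (i + 1), σ k

/-- Generalized renormalization-group iterates `Pⁱ` (with reference pmf `Q`):
`P⁰ x = exp(-(λ/σ₀) L x) Q x / Z₀` and, with `θ_i = σ̄_i/σ̄_{i+1}`,
`P^{i+1} y = (Uⁱ y)^{θ_i} (Q^{(i+1)} y)^{1-θ_i} / Z_{i+1}`, where `Uⁱ` is the
pushforward of `Pⁱ` under `T i` and the `Z`'s are the normalizing constants. -/
noncomputable def GRGP {X : ℕ → Type*} [∀ i, Fintype (X i)] [∀ i, DecidableEq (X i)]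
    (T : ∀ i, X i → X (i + 1)) (σ : ℕ → ℝ) (L : X 0 → ℝ) (lam : ℝ)
    (Q : X 0 → ℝ) : ∀ i, X i → ℝ
  | 0 => fun x => Real.exp (-(lam / σ 0) * L x) * Q x /
      ∑ x', Real.exp (-(lam / σ 0) * L x') * Q x'
  | i + 1 => fun y =>
      (∑ x ∈ Finset.univ.filter (fun x => T i x = y), GRGP T σ L lam Q i x) ^
            (sbar σ i / sbar σ (i + 1)) *
          hpush T Q (i + 1) y ^ (1 - sbar σ i / sbar σ (i + 1)) /
        ∑ y', (∑ x ∈ Finset.univ.filter (fun x => T i x = y'), GRGP T σ L lam Q i x) ^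
            (sbar σ i / sbar σ (i + 1)) *
          hpush T Q (i + 1) y' ^ (1 - sbar σ i / sbar σ (i + 1))

/-- The coarse-grained distribution `Uⁱ`, the pushforward of `Pⁱ` under `T i`. -/
noncomputable def GRGU {X : ℕ → Type*} [∀ i, Fintype (X i)] [∀ i, DecidableEq (X i)]
    (T : ∀ i, X i → X (i + 1)) (σ : ℕ → ℝ) (L : X 0 → ℝ) (lam : ℝ)
    (Q : X 0 → ℝ) (i : ℕ) (y : X (i + 1)) : ℝ :=
  ∑ x ∈ Finset.univ.filter (fun x => T i x = y), GRGP T σ L lam Q i x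

/-- The generalized renormalization-group normalizing constants `Z_i`. -/
noncomputable def GRGZ {X : ℕ → Type*} [∀ i, Fintype (X i)] [∀ i, DecidableEq (X i)]
    (T : ∀ i, X i → X (i + 1)) (σ : ℕ → ℝ) (L : X 0 → ℝ) (lam : ℝ)
    (Q : X 0 → ℝ) : ℕ → ℝ
  | 0 => ∑ x, Real.exp (-(lam / σ 0) * L x) * Q x
  | i + 1 => ∑ y, GRGU T σ L lam Q i y ^ (sbar σ i / sbar σ (i + 1)) *
      hpush T Q (i + 1) y ^ (1 - sbar σ i / sbar σ (i + 1))

/-- The hierarchical trajectory `x^{(i)}` of a point `x`. -/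
def liftT {X : ℕ → Type*} (T : ∀ i, X i → X (i + 1)) : ∀ i, X 0 → X i
  | 0 => id
  | i + 1 => fun x => T i (liftT T i x)

/-- The distribution `P̃^{[λ]}`, obtained by disintegration:
`P̃^{[λ]}(x) = P^{d-1}(x^{(d-1)}) ∏_{i<d-1} Pⁱ(x^{(i)}) / Uⁱ(x^{(i+1)})`. -/
noncomputable def GPtilde {X : ℕ → Type*} [∀ i, Fintype (X i)] [∀ i, DecidableEq (X i)]
    (T : ∀ i, X i → X (i + 1)) (σ : ℕ → ℝ) (L : X 0 → ℝ) (lam : ℝ)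
    (Q : X 0 → ℝ) (d : ℕ) (x : X 0) : ℝ :=
  GRGP T σ L lam Q (d - 1) (liftT T (d - 1) x) *
    ∏ i ∈ Finset.range (d - 1),
      (GRGP T σ L lam Q i (liftT T i x) / GRGU T σ L lam Q i (liftT T (i + 1) x))

section HierarchicalPushforward

variable {X : ℕ → Type*} [∀ i, Fintype (X i)] [∀ i, DecidableEq (X i)]
  (T : ∀ i, X i → X (i + 1))

theorem sum_hpush_succ_mul (P : X 0 → ℝ) (i : ℕ) (f : X (i + 1) → ℝ) :
    ∑ y, hpush T P (i + 1) y * f y = ∑ x, hpush T P i x * f (T i x) := by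
  rw [← Finset.sum_fiberwise Finset.univ (T i)]
  refine Finset.sum_congr rfl fun y _ => ?_
  simp only [hpush, Finset.sum_mul]
  refine Finset.sum_congr rfl fun x hx => ?_
  rw [(Finset.mem_filter.mp hx).2]

theorem sum_hpush (P : X 0 → ℝ) (i : ℕ) : ∑ x, hpush T P i x = ∑ x, P x := by
  induction i with
  | zero => rfl
  | succ i ih => simpa [ih] using sum_hpush_succ_mul T P i fun _ => 1

theorem hpush_nonneg {P : X 0 → ℝ} (hP : ∀ x, 0 ≤ P x) (i : ℕ) (x : X i) :
    0 ≤ hpush T P i x := by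
  induction i with
  | zero => exact hP x
  | succ i ih => exact Finset.sum_nonneg fun y _ => ih y

theorem sum_fiber_pos {α β : Type*} [Fintype α] [DecidableEq β] {g : α → β}
    (hg : Function.Surjective g) {f : α → ℝ} (hf : ∀ x, 0 < f x) (y : β) :
    0 < ∑ x ∈ Finset.univ.filter (fun x => g x = y), f x := by
  obtain ⟨x, hx⟩ := hg y
  exact Finset.sum_pos (fun x _ => hf x) ⟨x, by simp [hx]⟩

theorem hpush_pos {P : X 0 → ℝ} (hP : ∀ x, 0 < P x) {n : ℕ}
    (hT : ∀ i, i < n → Function.Surjective (T i)) {i : ℕ} (hi : i ≤ n) (x : X i) :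
    0 < hpush T P i x := by
  induction i with
  | zero => exact hP x
  | succ i ih => exact sum_fiber_pos (hT i hi) (ih (by lia)) x

/-- The density on `X 0` whose `n`-th pushforward is `g` and whose conditionals at the levels
below `n` are those of `p`. -/
noncomputable def disint (p : ∀ i, X i → ℝ) (n : ℕ) (g : X n → ℝ) (x : X 0) : ℝ :=
  g (liftT T n x) * ∏ i ∈ Finset.range n, (p i (liftT T i x) /
    ∑ z ∈ Finset.univ.filter (fun z => T i z = liftT T (i + 1) x), p i z)

theorem disint_succ (p : ∀ i, X i → ℝ) (n : ℕ) (g : X (n + 1) → ℝ) :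
    disint T p (n + 1) g = disint T p n fun y => g (T n y) *
      (p n y / ∑ z ∈ Finset.univ.filter (fun z => T n z = T n y), p n z) := by
  funext x
  rw [disint, disint, Finset.prod_range_succ, mul_comm (Finset.prod _ _), ← mul_assoc]
  rfl

theorem hpush_disint (p : ∀ i, X i → ℝ) (n : ℕ)
    (hp : ∀ i, i < n → ∀ y, ∑ z ∈ Finset.univ.filter (fun z => T i z = y), p i z ≠ 0)
    (g : X n → ℝ) : hpush T (disint T p n g) n = g := by
  induction n with
  | zero => funext x; simp [hpush, disint, liftT]
  | succ n ih =>
    funext y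
    rw [disint_succ, hpush, ih fun i hi => hp i (by lia)]
    have h : ∀ x ∈ Finset.univ.filter (fun x => T n x = y),
        g (T n x) * (p n x / ∑ z ∈ Finset.univ.filter (fun z => T n z = T n x), p n z) =
        g y / (∑ z ∈ Finset.univ.filter (fun z => T n z = y), p n z) * p n x := by
      intro x hx
      rw [(Finset.mem_filter.mp hx).2]
      ring
    beta_reduce
    rw [Finset.sum_congr rfl h, ← Finset.mul_sum, div_mul_cancel₀ _ (hp n (by lia) y)]

theorem disint_eq_disint_hpush (p : ∀ i, X i → ℝ) {n : ℕ}
    (hp : ∀ i, i < n → ∀ y, ∑ z ∈ Finset.univ.filter (fun z => T i z = y), p i z ≠ 0)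
    (g : X n → ℝ) {k : ℕ} (hk : k ≤ n) :
    disint T p n g = disint T p k (hpush T (disint T p n g) k) := by
  induction hk using Nat.decreasingInduction with
  | self => rw [hpush_disint T p n hp]
  | of_succ k hk ih =>
    rw [disint_succ] at ih
    have h := hpush_disint T p k (fun i hi => hp i (by lia)) fun y =>
      hpush T (disint T p n g) (k + 1) (T k y) *
        (p k y / ∑ z ∈ Finset.univ.filter (fun z => T k z = T k y), p k z)
    rw [← ih] at h
    rwa [h]

theorem hpush_disint_of_lt (p : ∀ i, X i → ℝ) {n : ℕ}
    (hp : ∀ i, i < n → ∀ y, ∑ z ∈ Finset.univ.filter (fun z => T i z = y), p i z ≠ 0)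
    (g : X n → ℝ) {k : ℕ} (hk : k < n) (x : X k) :
    hpush T (disint T p n g) k x = hpush T (disint T p n g) (k + 1) (T k x) *
      (p k x / ∑ z ∈ Finset.univ.filter (fun z => T k z = T k x), p k z) := by
  conv_lhs => rw [disint_eq_disint_hpush T p hp g hk, disint_succ,
    hpush_disint T p k fun i hi => hp i (by lia)]

end HierarchicalPushforward

theorem relEnt_eq_sum_sub {α : Type*} [Fintype α] {R S : α → ℝ} (hR : ∀ x, 0 ≤ R x)
    (hS : ∀ x, 0 < S x) :
    relEnt R S = ∑ x, R x * Real.log (R x) - ∑ x, R x * Real.log (S x) := by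
  rw [relEnt, Finset.sum_filter, ← Finset.sum_sub_distrib]
  refine Finset.sum_congr rfl fun x _ => ?_
  split_ifs with h
  · rw [Real.log_div h.ne' (hS x).ne']
    ring
  · simp [le_antisymm (not_lt.mp h) (hR x)]

theorem sbar_pos {σ : ℕ → ℝ} {d : ℕ} (hσ : ∀ i, i < d → 0 < σ i) {i : ℕ} (hi : i < d) :
    0 < sbar σ i :=
  Finset.sum_pos (fun k hk => hσ k (by simp at hk; lia)) (by simp)

theorem sbar_succ (σ : ℕ → ℝ) (i : ℕ) : sbar σ (i + 1) = sbar σ i + σ (i + 1) :=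
  Finset.sum_range_succ _ _

section RenormalizationGroup

variable {X : ℕ → Type*} [∀ i, Fintype (X i)] [∀ i, Nonempty (X i)] [∀ i, DecidableEq (X i)]
  (T : ∀ i, X i → X (i + 1)) {n : ℕ} (hT : ∀ i, i < n → Function.Surjective (T i))
  (σ : ℕ → ℝ) (L : X 0 → ℝ) (lam : ℝ) {Q : X 0 → ℝ} (hQ : ∀ x, 0 < Q x)

omit [∀ i, Nonempty (X i)] in
theorem GRGP_succ (Q : X 0 → ℝ) (i : ℕ) (y : X (i + 1)) :
    GRGP T σ L lam Q (i + 1) y = GRGU T σ L lam Q i y ^ (sbar σ i / sbar σ (i + 1)) *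
      hpush T Q (i + 1) y ^ (1 - sbar σ i / sbar σ (i + 1)) / GRGZ T σ L lam Q (i + 1) :=
  rfl

include hQ in
theorem GRGZ_zero_pos : 0 < GRGZ T σ L lam Q 0 :=
  Finset.sum_pos (fun x _ => mul_pos (Real.exp_pos _) (hQ x)) Finset.univ_nonempty

include hT hQ in
theorem GRGZ_succ_pos {i : ℕ} (hi : i < n) (hU : ∀ y, 0 < GRGU T σ L lam Q i y) :
    0 < GRGZ T σ L lam Q (i + 1) :=
  Finset.sum_pos (fun y _ => mul_pos (Real.rpow_pos_of_pos (hU y) _)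
    (Real.rpow_pos_of_pos (hpush_pos T hQ hT hi y) _)) Finset.univ_nonempty

include hT hQ in
theorem GRGP_pos {i : ℕ} (hi : i ≤ n) (x : X i) : 0 < GRGP T σ L lam Q i x := by
  induction i with
  | zero => exact div_pos (mul_pos (Real.exp_pos _) (hQ x)) (GRGZ_zero_pos T σ L lam hQ)
  | succ i ih =>
    have hU : ∀ y, 0 < GRGU T σ L lam Q i y := sum_fiber_pos (hT i hi) (ih (by lia))
    exact div_pos (mul_pos (Real.rpow_pos_of_pos (hU x) _)
      (Real.rpow_pos_of_pos (hpush_pos T hQ hT hi x) _)) (GRGZ_succ_pos T hT σ L lam hQ hi hU)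

include hT hQ in
theorem GRGU_pos {i : ℕ} (hi : i < n) (y : X (i + 1)) : 0 < GRGU T σ L lam Q i y :=
  sum_fiber_pos (hT i hi) (GRGP_pos T hT σ L lam hQ hi.le) y

include hT hQ in
theorem GRGZ_pos {i : ℕ} (hi : i ≤ n) : 0 < GRGZ T σ L lam Q i := by
  cases i with
  | zero => exact GRGZ_zero_pos T σ L lam hQ
  | succ i => exact GRGZ_succ_pos T hT σ L lam hQ hi (GRGU_pos T hT σ L lam hQ hi)

include hT hQ in
theorem sum_GRGP {i : ℕ} (hi : i ≤ n) : ∑ x, GRGP T σ L lam Q i x = 1 := by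
  have hZ := (GRGZ_pos T hT σ L lam hQ hi).ne'
  cases i with
  | zero => exact (Finset.sum_div _ _ _).symm.trans (div_self hZ)
  | succ i => exact (Finset.sum_div _ _ _).symm.trans (div_self hZ)

include hQ in
theorem log_GRGP_zero (hσ : σ 0 ≠ 0) (x : X 0) :
    σ 0 * Real.log (GRGP T σ L lam Q 0 x) =
      σ 0 * Real.log (Q x) - lam * L x - σ 0 * Real.log (GRGZ T σ L lam Q 0) := by
  change σ 0 * Real.log (Real.exp (-(lam / σ 0) * L x) * Q x / GRGZ T σ L lam Q 0) = _
  rw [Real.log_div (mul_pos (Real.exp_pos _) (hQ x)).ne' (GRGZ_zero_pos T σ L lam hQ).ne',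
    Real.log_mul (Real.exp_pos _).ne' (hQ x).ne', Real.log_exp]
  field_simp
  ring

include hT hQ in
theorem log_GRGP_succ {i : ℕ} (hi : i < n) (hσ : sbar σ (i + 1) ≠ 0) (y : X (i + 1)) :
    sbar σ (i + 1) * Real.log (GRGP T σ L lam Q (i + 1) y) =
      sbar σ i * Real.log (GRGU T σ L lam Q i y) +
        σ (i + 1) * Real.log (hpush T Q (i + 1) y) -
        sbar σ (i + 1) * Real.log (GRGZ T σ L lam Q (i + 1)) := by
  have hU := GRGU_pos T hT σ L lam hQ hi y
  have hq := hpush_pos T hQ hT hi y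
  have hs : σ (i + 1) = sbar σ (i + 1) - sbar σ i := by rw [sbar_succ]; ring
  rw [GRGP_succ, Real.log_div
    (mul_pos (Real.rpow_pos_of_pos hU _) (Real.rpow_pos_of_pos hq _)).ne'
    (GRGZ_pos T hT σ L lam hQ hi).ne',
    Real.log_mul (Real.rpow_pos_of_pos hU _).ne' (Real.rpow_pos_of_pos hq _).ne',
    Real.log_rpow hU, Real.log_rpow hq, hs]
  field_simp

include hT hQ in
theorem hpush_GPtilde_self : hpush T (GPtilde T σ L lam Q (n + 1)) n = GRGP T σ L lam Q n :=
  hpush_disint T _ n (fun _ hi y => (GRGU_pos T hT σ L lam hQ hi y).ne') _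

include hT hQ in
theorem hpush_GPtilde_of_lt {k : ℕ} (hk : k < n) (x : X k) :
    hpush T (GPtilde T σ L lam Q (n + 1)) k x =
      hpush T (GPtilde T σ L lam Q (n + 1)) (k + 1) (T k x) *
        (GRGP T σ L lam Q k x / GRGU T σ L lam Q k (T k x)) :=
  hpush_disint_of_lt T _ (fun _ hi y => (GRGU_pos T hT σ L lam hQ hi y).ne') _ hk x

include hT hQ in
theorem GPtilde_pos (x : X 0) : 0 < GPtilde T σ L lam Q (n + 1) x :=
  mul_pos (GRGP_pos T hT σ L lam hQ le_rfl _) <| Finset.prod_pos fun _ hi =>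
    have hi := Finset.mem_range.mp hi
    div_pos (GRGP_pos T hT σ L lam hQ hi.le _) (GRGU_pos T hT σ L lam hQ hi _)

include hT hQ in
theorem sum_GPtilde : ∑ x, GPtilde T σ L lam Q (n + 1) x = 1 := by
  rw [← sum_hpush T _ n, hpush_GPtilde_self T hT σ L lam hQ, sum_GRGP T hT σ L lam hQ le_rfl]

include hT hQ in
/-- Telescoping form of the variational identity, truncated at level `m`. -/
theorem sum_log_GPtilde_sub (hσ : ∀ i, i < n + 1 → 0 < σ i) {P : X 0 → ℝ}
    (hP : ∑ x, P x = 1) {m : ℕ} (hm : m ≤ n) :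
    ∑ i ∈ Finset.range (m + 1), σ i *
        (∑ x, hpush T P i x * Real.log (hpush T (GPtilde T σ L lam Q (n + 1)) i x) -
          ∑ x, hpush T P i x * Real.log (hpush T Q i x)) + lam * ∑ x, P x * L x =
      sbar σ m *
        (∑ x, hpush T P m x * Real.log (hpush T (GPtilde T σ L lam Q (n + 1)) m x) -
          ∑ x, hpush T P m x * Real.log (GRGP T σ L lam Q m x)) -
      ∑ i ∈ Finset.range (m + 1), sbar σ i * Real.log (GRGZ T σ L lam Q i) := by
  induction m with
  | zero =>
    have h : σ 0 * ∑ x, P x * Real.log (GRGP T σ L lam Q 0 x) =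
        σ 0 * ∑ x, P x * Real.log (Q x) - lam * ∑ x, P x * L x -
          (∑ x, P x) * (σ 0 * Real.log (GRGZ T σ L lam Q 0)) := by
      simp only [Finset.mul_sum, Finset.sum_mul, ← Finset.sum_sub_distrib]
      refine Finset.sum_congr rfl fun x _ => ?_
      linear_combination P x * log_GRGP_zero T σ L lam hQ (hσ 0 (by lia)).ne' x
    rw [hP] at h
    simp only [zero_add, Finset.sum_range_one, hpush, sbar]
    linear_combination h
  | succ m ih =>
    have h₁ : sbar σ (m + 1) *
          ∑ y, hpush T P (m + 1) y * Real.log (GRGP T σ L lam Q (m + 1) y) =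
        sbar σ m * ∑ y, hpush T P (m + 1) y * Real.log (GRGU T σ L lam Q m y) +
          σ (m + 1) * ∑ y, hpush T P (m + 1) y * Real.log (hpush T Q (m + 1) y) -
          (∑ y, hpush T P (m + 1) y) *
            (sbar σ (m + 1) * Real.log (GRGZ T σ L lam Q (m + 1))) := by
      simp only [Finset.mul_sum, Finset.sum_mul, ← Finset.sum_sub_distrib,
        ← Finset.sum_add_distrib]
      refine Finset.sum_congr rfl fun y _ => ?_
      linear_combination hpush T P (m + 1) y *
        log_GRGP_succ T hT σ L lam hQ hm (sbar_pos hσ (by lia)).ne' y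
    have h₂ : ∑ x, hpush T P m x * Real.log (hpush T (GPtilde T σ L lam Q (n + 1)) m x) =
        ∑ y, hpush T P (m + 1) y *
            Real.log (hpush T (GPtilde T σ L lam Q (n + 1)) (m + 1) y) +
          ∑ x, hpush T P m x * Real.log (GRGP T σ L lam Q m x) -
          ∑ y, hpush T P (m + 1) y * Real.log (GRGU T σ L lam Q m y) := by
      rw [sum_hpush_succ_mul T P m fun y => Real.log (GRGU T σ L lam Q m y),
        sum_hpush_succ_mul T P m fun y =>
          Real.log (hpush T (GPtilde T σ L lam Q (n + 1)) (m + 1) y),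
        ← Finset.sum_add_distrib, ← Finset.sum_sub_distrib]
      refine Finset.sum_congr rfl fun x _ => ?_
      have hp := GRGP_pos T hT σ L lam hQ (by lia : m ≤ n) x
      have hU := GRGU_pos T hT σ L lam hQ hm (T m x)
      rw [hpush_GPtilde_of_lt T hT σ L lam hQ hm, Real.log_mul
        (hpush_pos T (GPtilde_pos T hT σ L lam hQ) hT hm _).ne' (div_pos hp hU).ne',
        Real.log_div hp.ne' hU.ne']
      ring
    rw [sum_hpush, hP] at h₁
    rw [Finset.sum_range_succ _ (m + 1), Finset.sum_range_succ _ (m + 1)]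
    linear_combination ih (by lia) + h₁ + sbar σ m * h₂ - (∑ y, hpush T P (m + 1) y *
      Real.log (hpush T (GPtilde T σ L lam Q (n + 1)) (m + 1) y)) * sbar_succ σ m

end RenormalizationGroup

/-- Hierarchical Gibbs variational principle for relative entropy (discrete
case): `P̃^{[λ]}` is a strictly positive pmf and, for every pmf `P` on `X 0`,
`D_{(σ,T)}(P‖Q) + λ E_P[L] = D_{(σ,T)}(P ‖ P̃^{[λ]}) - ∑ σ̄_i log Z_i`. -/
theorem stmt_16 (d : ℕ) (hd : 1 ≤ d) (X : ℕ → Type*) [∀ i, Fintype (X i)]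
    [∀ i, Nonempty (X i)] [∀ i, DecidableEq (X i)]
    (T : ∀ i, X i → X (i + 1)) (hT : ∀ i, i < d - 1 → Function.Surjective (T i))
    (σ : ℕ → ℝ) (hσ : ∀ i, i < d → 0 < σ i) (L : X 0 → ℝ) (lam : ℝ)
    (Q : X 0 → ℝ) (hQpos : ∀ x, 0 < Q x) (hQ1 : ∑ x, Q x = 1) :
    (∀ x, 0 < GPtilde T σ L lam Q d x) ∧
    (∑ x, GPtilde T σ L lam Q d x = 1) ∧
    ∀ P : X 0 → ℝ, (∀ x, 0 ≤ P x) → (∑ x, P x = 1) →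
      ∑ i ∈ Finset.range d, σ i * relEnt (hpush T P i) (hpush T Q i) +
          lam * ∑ x, P x * L x =
        ∑ i ∈ Finset.range d,
            σ i * relEnt (hpush T P i) (hpush T (GPtilde T σ L lam Q d) i) -
          ∑ i ∈ Finset.range d, sbar σ i * Real.log (GRGZ T σ L lam Q i) := by
  obtain ⟨n, rfl⟩ : ∃ n, d = n + 1 := ⟨d - 1, by lia⟩
  have hT : ∀ i, i < n → Function.Surjective (T i) := hT
  have hG := GPtilde_pos T hT σ L lam hQpos
  refine ⟨hG, sum_GPtilde T hT σ L lam hQpos, fun P hP hP1 => ?_⟩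
  have h := sum_log_GPtilde_sub T hT σ L lam hQpos hσ hP1 le_rfl
  rw [hpush_GPtilde_self T hT σ L lam hQpos, sub_self, mul_zero] at h
  have hdiff : ∑ i ∈ Finset.range (n + 1), σ i * relEnt (hpush T P i) (hpush T Q i) -
      ∑ i ∈ Finset.range (n + 1),
        σ i * relEnt (hpush T P i) (hpush T (GPtilde T σ L lam Q (n + 1)) i) =
      ∑ i ∈ Finset.range (n + 1), σ i *
        (∑ x, hpush T P i x * Real.log (hpush T (GPtilde T σ L lam Q (n + 1)) i x) -
          ∑ x, hpush T P i x * Real.log (hpush T Q i x)) := by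
    rw [← Finset.sum_sub_distrib]
    refine Finset.sum_congr rfl fun i hi => ?_
    have hi : i ≤ n := Nat.lt_succ_iff.mp (Finset.mem_range.mp hi)
    rw [relEnt_eq_sum_sub (hpush_nonneg T hP i) (hpush_pos T hQpos hT hi),
      relEnt_eq_sum_sub (hpush_nonneg T hP i) (hpush_pos T hG hT hi)]
    ring
  linear_combination h + hdiff
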